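/- Suppose d' = 2d. Then, as (α,β) ranges over F_{p^m} × F_q, the value T(α,β) equals: −p^m for exactly p^{3d}(p^m−1)(p^n−p^{n−2d}−p^{n−3d}+p^m−p^{m−d}+1)/((p^d+1)(p^{2d}−1)) pairs; p^{m+d} for exactly p^d(p^n−1)(p^m+p^{m−d}+p^{m−2d}+1)/(p^d+1)^2 pairs; −p^{m+2d} for exactly (p^{m−d}−1)(p^n−1)/((p^d+1)(p^{2d}−1)) pairs; and p^n for exactly 1 pair (namely (0,0)); T(α,β) takes no other values. -/

import Mathlib

open scoped BigOperators Classical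

noncomputable section

/-- The map `φ_{α,β}(x) = α x^{p^m} + β x^{p^k} + β^{p^{n-k}} x^{p^{n-k}}`. -/
def phiMap (p m n k : ℕ) {F : Type} [Field F] (α β x : F) : F :=
  α * x ^ p ^ m + β * x ^ p ^ k + β ^ p ^ (n - k) * x ^ p ^ (n - k)

/-- The trace-type sum `x ↦ ∑_{i<r} x^{p^{t i}}`; for `x` in the subfield of size
`p^{t·r}` this is the relative trace down to the subfield of size `p^t`. -/
def trSum (p t r : ℕ) {F : Type} [Field F] (x : F) : F :=
  ∑ i ∈ Finset.range r, x ^ p ^ (t * i)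

/-- `ζ_p^c = exp(2πi·c̃/p)` for a lift `c̃` of `c : F_p`. -/
noncomputable def expChar (p : ℕ) (c : ZMod p) : ℂ :=
  Complex.exp (2 * Real.pi * Complex.I * (c.val : ℂ) / (p : ℂ))

/-- Identify an element of the prime field of `F` with an element of `ZMod p`
(the partial inverse of the algebra map). -/
noncomputable def fToZMod (p : ℕ) {F : Type} [Field F] [Algebra (ZMod p) F] (x : F) : ZMod p :=
  letI : Nonempty (ZMod p) := ⟨0⟩
  Function.invFun (algebraMap (ZMod p) F) x

/-- `T(α,β) = ∑_{x ∈ F_q} ζ_p^{Tr^m_1(α x^{p^m+1}) + Tr^n_1(β x^{p^k+1})}`. -/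
noncomputable def Tsum (p m n k : ℕ) (F : Type) [Field F] [Fintype F] [Algebra (ZMod p) F]
    (α β : F) : ℂ :=
  ∑ x : F, expChar p (fToZMod p (trSum p 1 m (α * x ^ (p ^ m + 1))) +
      fToZMod p (trSum p 1 n (β * x ^ (p ^ k + 1))))

/-- `S(α,β,γ) = ∑_{x ∈ F_q} ζ_p^{Tr^m_1(α x^{p^m+1}) + Tr^n_1(β x^{p^k+1} + γ x)}`. -/
noncomputable def Ssum (p m n k : ℕ) (F : Type) [Field F] [Fintype F] [Algebra (ZMod p) F]
    (α β γ : F) : ℂ :=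
  ∑ x : F, expChar p (fToZMod p (trSum p 1 m (α * x ^ (p ^ m + 1))) +
      fToZMod p (trSum p 1 n (β * x ^ (p ^ k + 1) + γ * x)))

/-- `√(q₀*)` where `q₀* = (−1)^{(q₀−1)/2} q₀`. -/
noncomputable def sqrtStar (q0 : ℕ) : ℂ :=
  if q0 % 4 = 1 then (Real.sqrt q0 : ℂ) else Complex.I * (Real.sqrt q0 : ℂ)

/-- `ζ_p = exp(2πi/p)`. -/
noncomputable def zetaC (p : ℕ) : ℂ := Complex.exp (2 * Real.pi * Complex.I / (p : ℂ))

/-- Number of pairs `(α,β) ∈ F_{p^m} × F_q` with `T(α,β) = v`. -/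
noncomputable def Tcount (p m n k : ℕ) (F : Type) [Field F] [Fintype F] [Algebra (ZMod p) F]
    (v : ℂ) : ℕ :=
  Nat.card {ab : F × F // ab.1 ^ p ^ m = ab.1 ∧ Tsum p m n k F ab.1 ab.2 = v}

/-- Number of triples `(α,β,γ) ∈ F_{p^m} × F_q × F_q` with `S(α,β,γ) = v`. -/
noncomputable def Scount (p m n k : ℕ) (F : Type) [Field F] [Fintype F] [Algebra (ZMod p) F]
    (v : ℂ) : ℕ :=
  Nat.card {abc : F × F × F // abc.1 ^ p ^ m = abc.1 ∧ Ssum p m n k F abc.1 abc.2.1 abc.2.2 = v}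

/-- Hamming weight of the codeword of `C₁` attached to `(α,β)`:
the number of `0 ≤ i ≤ q-2` with `Tr^m_t(α π^{i(p^m+1)}) + Tr^n_t(β π^{i(p^k+1)}) ≠ 0`. -/
noncomputable def wt1 (p m n k t : ℕ) {F : Type} [Field F] (π α β : F) : ℕ :=
  Nat.card {i : ℕ // i ≤ p ^ n - 2 ∧
    trSum p t (m / t) (α * π ^ (i * (p ^ m + 1))) +
    trSum p t (n / t) (β * π ^ (i * (p ^ k + 1))) ≠ 0}

/-- Number of pairs `(α,β) ∈ F_{p^m} × F_q` whose `C₁`-codeword has weight `v`. -/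
noncomputable def wt1count (p m n k t : ℕ) (F : Type) [Field F] [Fintype F] (π : F) (v : ℕ) : ℕ :=
  Nat.card {ab : F × F // ab.1 ^ p ^ m = ab.1 ∧ wt1 p m n k t π ab.1 ab.2 = v}

/-- Hamming weight of the codeword of `C₂` attached to `(α,β,γ)`. -/
noncomputable def wt2 (p m n k t : ℕ) {F : Type} [Field F] (π α β γ : F) : ℕ :=
  Nat.card {i : ℕ // i ≤ p ^ n - 2 ∧
    trSum p t (m / t) (α * π ^ (i * (p ^ m + 1))) +
    trSum p t (n / t) (β * π ^ (i * (p ^ k + 1)) + γ * π ^ i) ≠ 0}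

/-- Number of triples `(α,β,γ)` whose `C₂`-codeword has weight `v`. -/
noncomputable def wt2count (p m n k t : ℕ) (F : Type) [Field F] [Fintype F] (π : F) (v : ℕ) : ℕ :=
  Nat.card {abc : F × F × F // abc.1 ^ p ^ m = abc.1 ∧ wt2 p m n k t π abc.1 abc.2.1 abc.2.2 = v}


/-! ### The trace character -/

section TraceCharacter

variable {p : ℕ} [hp : Fact p.Prime] {F : Type} [Field F] [Fintype F] [Algebra (ZMod p) F]

lemma expChar_eq_stdAddChar (c : ZMod p) : expChar p c = ZMod.stdAddChar c := by
  have h := ZMod.stdAddChar_coe (N := p) (c.val : ℤ)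
  rw [Int.cast_natCast, ZMod.natCast_zmod_val] at h
  rw [h, expChar]
  push_cast
  rfl

lemma fToZMod_algebraMap {p : ℕ} [Fact p.Prime] {F : Type} [Field F] [Algebra (ZMod p) F]
    (a : ZMod p) : fToZMod p (algebraMap (ZMod p) F a) = a :=
  Function.leftInverse_invFun (algebraMap (ZMod p) F).injective a

lemma pow_card_pow {p : ℕ} {F : Type} [Field F] [Fintype F]
    {n : ℕ} (hF : Fintype.card F = p ^ n) (x : F) : x ^ p ^ n = x := by
  rw [← hF, FiniteField.pow_card]

lemma finrank_eq {n : ℕ} (hF : Fintype.card F = p ^ n) : Module.finrank (ZMod p) F = n := by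
  have h := Module.card_eq_pow_finrank (K := ZMod p) (V := F)
  rw [ZMod.card, hF] at h
  exact (Nat.pow_right_injective hp.out.two_le h).symm

lemma algebraMap_trace_eq_trSum {n : ℕ} (hF : Fintype.card F = p ^ n) (x : F) :
    algebraMap (ZMod p) F (Algebra.trace (ZMod p) F x) = trSum p 1 n x := by
  rw [FiniteField.algebraMap_trace_eq_sum_pow, finrank_eq hF]
  simp [trSum]

lemma trace_pow_char_pow (x : F) (j : ℕ) :
    Algebra.trace (ZMod p) F (x ^ p ^ j) = Algebra.trace (ZMod p) F x := by
  have h : ∀ y : F, Algebra.trace (ZMod p) F (y ^ p) = Algebra.trace (ZMod p) F y := fun y => by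
    have := Algebra.trace_eq_of_algEquiv
      (FiniteField.frobeniusAlgEquivOfAlgebraic (ZMod p) F) y
    simpa [ZMod.card] using this
  induction j with
  | zero => simp
  | succ j ih => rw [pow_succ, pow_mul, h, ih]

/-- The canonical additive character `x ↦ ζ_p ^ Tr(x)` of `F`. -/
noncomputable def traceChar (p : ℕ) [Fact p.Prime] (F : Type) [Field F] [Algebra (ZMod p) F] :
    AddChar F ℂ :=
  (ZMod.stdAddChar (N := p)).compAddMonoidHom (Algebra.trace (ZMod p) F).toAddMonoidHom

lemma traceChar_apply {p : ℕ} [Fact p.Prime] {F : Type} [Field F] [Algebra (ZMod p) F]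
    (x : F) :
    traceChar p F x = ZMod.stdAddChar (Algebra.trace (ZMod p) F x) := rfl

lemma traceChar_pow_char_pow (x : F) (j : ℕ) : traceChar p F (x ^ p ^ j) = traceChar p F x := by
  rw [traceChar_apply, traceChar_apply, trace_pow_char_pow]

lemma traceChar_isPrimitive : (traceChar p F).IsPrimitive := by
  apply AddChar.IsPrimitive.of_ne_one
  intro h
  obtain ⟨x, hx⟩ := Algebra.trace_surjective (ZMod p) F 1
  have h1 : traceChar p F x = 1 := by rw [h]; rfl
  rw [traceChar_apply, hx, ← AddChar.map_zero_eq_one (ZMod.stdAddChar (N := p))] at h1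
  exact one_ne_zero (ZMod.injective_stdAddChar h1)

lemma traceChar_starRingEnd (x : F) :
    starRingEnd ℂ (traceChar p F x) = traceChar p F (-x) := by
  rw [AddChar.map_neg_eq_conj]

/-- The quadratic function whose trace is the exponent of `T(α, β)`. -/
def quadFun (p m k : ℕ) {F : Type} [Field F] (α β x : F) : F :=
  α / 2 * x ^ (p ^ m + 1) + β * x ^ (p ^ k + 1)

lemma charP_of_algebra (p : ℕ) [Fact p.Prime] (F : Type) [Field F] [Algebra (ZMod p) F] :
    CharP F p :=
  charP_of_injective_algebraMap (algebraMap (ZMod p) F).injective p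

lemma two_ne_zero_of_odd {p : ℕ} [hp : Fact p.Prime] {F : Type} [Field F] [Algebra (ZMod p) F]
    (hodd : p % 2 = 1) : (2 : F) ≠ 0 := by
  have := charP_of_algebra p F
  have h2 : ((2 : ℕ) : F) ≠ 0 := by
    rw [Ne, CharP.cast_eq_zero_iff F p]
    intro h
    have := (Nat.prime_dvd_prime_iff_eq hp.out Nat.prime_two).1 h
    omega
  exact_mod_cast h2

lemma two_pow_char_pow {p : ℕ} [Fact p.Prime] {F : Type} [Field F] [Algebra (ZMod p) F]
    (j : ℕ) : (2 : F) ^ p ^ j = 2 := by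
  have := charP_of_algebra p F
  have h := add_pow_char_pow (n := j) (p := p) (1 : F) 1
  rw [one_pow, one_add_one_eq_two] at h
  exact h

lemma pow_norm_fixed {p : ℕ} {F : Type} [Field F] [Fintype F]
    {m : ℕ} (hF : Fintype.card F = p ^ (2 * m)) (x : F) :
    (x ^ (p ^ m + 1)) ^ p ^ m = x ^ (p ^ m + 1) := by
  have := pow_card_pow hF x
  rw [← pow_mul, add_mul, one_mul, ← pow_add, ← two_mul, pow_add, this, pow_add, pow_one, mul_comm]

lemma trSum_half {m : ℕ} (hodd : p % 2 = 1) (hF : Fintype.card F = p ^ (2 * m)) {y : F}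
    (hy : y ^ p ^ m = y) :
    trSum p 1 m y = algebraMap (ZMod p) F (Algebra.trace (ZMod p) F (y / 2)) := by
  have h2 := two_ne_zero_of_odd (p := p) (F := F) hodd
  rw [algebraMap_trace_eq_trSum hF, trSum, trSum, two_mul, Finset.sum_range_add,
    ← Finset.sum_add_distrib]
  refine Finset.sum_congr rfl fun i _ => ?_
  rw [one_mul, one_mul, pow_add p m, pow_mul, div_pow, div_pow, hy, two_pow_char_pow, div_pow,
    two_pow_char_pow]
  field_simp
  rw [two_pow_char_pow]
  ring

lemma Tsum_eq {m k : ℕ} (hodd : p % 2 = 1) (hF : Fintype.card F = p ^ (2 * m)) {α : F} (β : F)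
    (hα : α ^ p ^ m = α) :
    Tsum p m (2 * m) k F α β = ∑ x : F, traceChar p F (quadFun p m k α β x) := by
  refine Finset.sum_congr rfl fun x _ => ?_
  rw [expChar_eq_stdAddChar, ← algebraMap_trace_eq_trSum hF,
    trSum_half hodd hF (by rw [mul_pow, hα, pow_norm_fixed hF]), fToZMod_algebraMap,
    fToZMod_algebraMap, ← map_add, traceChar_apply, quadFun, div_mul_eq_mul_div]

end TraceCharacter

/-! ### The polar form and the modulus of the exponential sum -/

section Modulus

variable {p : ℕ} [hp : Fact p.Prime] {F : Type} [Field F] [Fintype F] [Algebra (ZMod p) F]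
  {m k : ℕ} {α β : F}

lemma phiMap_zero (p m n k : ℕ) [Fact p.Prime] {F : Type} [Field F] (α β : F) :
    phiMap p m n k α β 0 = 0 := by
  have h : ∀ j, p ^ j ≠ 0 := fun j => pow_ne_zero _ (Fact.out : p.Prime).ne_zero
  simp [phiMap, zero_pow (h _)]

lemma trace_quadFun_add (hodd : p % 2 = 1) (hF : Fintype.card F = p ^ (2 * m))
    (hk : k ≤ 2 * m) (hα : α ^ p ^ m = α) (y z : F) :
    Algebra.trace (ZMod p) F (quadFun p m k α β (y + z)) =
      Algebra.trace (ZMod p) F (quadFun p m k α β y) +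
      Algebra.trace (ZMod p) F (quadFun p m k α β z) +
      Algebra.trace (ZMod p) F (y * phiMap p m (2 * m) k α β z) := by
  have := charP_of_algebra p F
  have h2 := two_ne_zero_of_odd (p := p) (F := F) hodd
  have h1 : Algebra.trace (ZMod p) F (α / 2 * z * y ^ p ^ m) =
      Algebra.trace (ZMod p) F (α / 2 * z ^ p ^ m * y) := by
    rw [← trace_pow_char_pow _ m, mul_pow, mul_pow, div_pow, hα, two_pow_char_pow, ← pow_mul,
      ← pow_add, ← two_mul, pow_card_pow hF]
  have h3 : Algebra.trace (ZMod p) F (β * z * y ^ p ^ k) =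
      Algebra.trace (ZMod p) F (y * (β ^ p ^ (2 * m - k) * z ^ p ^ (2 * m - k))) := by
    rw [← trace_pow_char_pow _ (2 * m - k), mul_pow, mul_pow, ← pow_mul y,
      ← pow_add, Nat.add_sub_cancel' hk, pow_card_pow hF, mul_comm]
  have h4 : quadFun p m k α β (y + z) = quadFun p m k α β y + quadFun p m k α β z +
      (α / 2 * z * y ^ p ^ m + α / 2 * z ^ p ^ m * y + β * z * y ^ p ^ k +
        β * z ^ p ^ k * y) := by
    simp only [quadFun, pow_succ, add_pow_char_pow]
    ring
  rw [h4]
  simp only [map_add]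
  rw [h1, h3, ← map_add, ← map_add, ← map_add, ← map_add, ← map_add]
  rw [← map_add, phiMap]
  congr 1
  field_simp
  ring

lemma trace_quadFun_eq_zero (hodd : p % 2 = 1) (hF : Fintype.card F = p ^ (2 * m))
    (hk : k ≤ 2 * m) (hα : α ^ p ^ m = α) {z : F} (hz : phiMap p m (2 * m) k α β z = 0) :
    Algebra.trace (ZMod p) F (quadFun p m k α β z) = 0 := by
  have h := trace_quadFun_add (β := β) hodd hF hk hα z z
  have h4 : quadFun p m k α β (z + z) =
      (quadFun p m k α β z + quadFun p m k α β z) + (quadFun p m k α β z + quadFun p m k α β z) := by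
    simp only [quadFun, ← two_mul, mul_pow, pow_succ, two_pow_char_pow]
    ring
  rw [h4, hz, mul_zero, map_zero, add_zero, map_add, map_add, add_eq_left, ← two_mul,
    mul_eq_zero] at h
  exact h.resolve_left (two_ne_zero_of_odd (p := p) (F := ZMod p) hodd)

lemma normSq_sum_quadFun (hodd : p % 2 = 1) (hF : Fintype.card F = p ^ (2 * m))
    (hk : k ≤ 2 * m) (hα : α ^ p ^ m = α) :
    (∑ x : F, traceChar p F (quadFun p m k α β x)) *
      starRingEnd ℂ (∑ x : F, traceChar p F (quadFun p m k α β x)) =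
    (p : ℂ) ^ (2 * m) * (Nat.card {x : F // phiMap p m (2 * m) k α β x = 0} : ℂ) := by
  have key : ∀ y z : F, traceChar p F (quadFun p m k α β (z + y)) *
      starRingEnd ℂ (traceChar p F (quadFun p m k α β y)) =
      traceChar p F (quadFun p m k α β z) *
        traceChar p F (y * phiMap p m (2 * m) k α β z) := by
    intro y z
    rw [traceChar_starRingEnd, ← AddChar.map_add_eq_mul, ← AddChar.map_add_eq_mul,
      traceChar_apply, traceChar_apply]
    congr 1
    rw [map_add, map_neg, add_comm z y, trace_quadFun_add hodd hF hk hα, map_add]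
    ring
  have hinner : ∀ z : F, (∑ y : F, traceChar p F (quadFun p m k α β z) *
      traceChar p F (y * phiMap p m (2 * m) k α β z)) =
      if phiMap p m (2 * m) k α β z = 0 then (p : ℂ) ^ (2 * m) else 0 := by
    intro z
    rw [← Finset.mul_sum, AddChar.sum_mulShift _ traceChar_isPrimitive]
    split_ifs with h
    · rw [traceChar_apply, trace_quadFun_eq_zero hodd hF hk hα h, AddChar.map_zero_eq_one, hF]
      push_cast
      ring
    · simp
  calc _ = ∑ y : F, ∑ x : F, traceChar p F (quadFun p m k α β x) *
        starRingEnd ℂ (traceChar p F (quadFun p m k α β y)) := by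
        rw [map_sum, Finset.sum_mul_sum, Finset.sum_comm]
    _ = ∑ y : F, ∑ z : F, traceChar p F (quadFun p m k α β z) *
        traceChar p F (y * phiMap p m (2 * m) k α β z) := by
        refine Finset.sum_congr rfl fun y _ => ?_
        rw [← Equiv.sum_comp (Equiv.addRight y)]
        exact Finset.sum_congr rfl fun z _ => key y z
    _ = _ := by
        rw [Finset.sum_comm, Finset.sum_congr rfl fun z _ => hinner z, ← Finset.sum_filter,
          Finset.sum_const, Nat.card_eq_fintype_card, Fintype.card_subtype, nsmul_eq_mul, mul_comm]

end Modulus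

/-! ### Fixed points of powers of the Frobenius -/

section FixedPoints

lemma exists_pow_eq_of_pow_eq_one {G : Type*} [CommGroup G] [IsCyclic G] [Finite G] {e : ℕ}
    (he : e ∣ Nat.card G) {a : G} (ha : a ^ (Nat.card G / e) = 1) : ∃ c : G, c ^ e = a := by
  have hpos : 0 < Nat.card G := Nat.card_pos
  have hle : (powMonoidHom e : G →* G).range ≤ (powMonoidHom (Nat.card G / e) : G →* G).ker := by
    rintro _ ⟨c, rfl⟩
    rw [MonoidHom.mem_ker, powMonoidHom_apply, powMonoidHom_apply, ← pow_mul,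
      Nat.mul_div_cancel' he, pow_card_eq_one']
  have hcard : Nat.card (powMonoidHom (Nat.card G / e) : G →* G).ker ≤
      Nat.card (powMonoidHom e : G →* G).range := by
    rw [IsCyclic.card_powMonoidHom_ker, IsCyclic.card_powMonoidHom_range,
      Nat.gcd_eq_right (Nat.div_dvd_of_dvd he), Nat.gcd_eq_right he]
  have heq := Subgroup.eq_of_le_of_card_ge hle hcard
  have hmem : a ∈ (powMonoidHom e : G →* G).range := by
    rw [heq, MonoidHom.mem_ker, powMonoidHom_apply, ha]
  exact hmem

lemma card_pow_eq_one_of_dvd {F : Type} [Field F] [Fintype F] {e : ℕ}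
    (he : e ∣ Fintype.card F - 1) : Nat.card {x : F // x ^ e = 1} = e := by
  have hq : 0 < Fintype.card F - 1 := by have := Fintype.one_lt_card (α := F); omega
  have he0 : e ≠ 0 := by rintro rfl; rw [zero_dvd_iff] at he; omega
  have hc : Nat.card Fˣ = Fintype.card F - 1 := by rw [Nat.card_units, Nat.card_eq_fintype_card]
  have h := IsCyclic.card_powMonoidHom_ker Fˣ e
  rw [hc, Nat.gcd_eq_right he] at h
  have hmem : ∀ u : (powMonoidHom e : Fˣ →* Fˣ).ker, ((u : Fˣ) : F) ^ e = 1 := fun u => by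
    have hu := u.2
    rw [MonoidHom.mem_ker, powMonoidHom_apply] at hu
    rw [← Units.val_pow_eq_pow_val, hu, Units.val_one]
  have hcard : Nat.card (powMonoidHom e : Fˣ →* Fˣ).ker = Nat.card {x : F // x ^ e = 1} := by
    refine Nat.card_congr (Equiv.ofBijective
      (fun u => (⟨((u : Fˣ) : F), hmem u⟩ : {x : F // x ^ e = 1})) ⟨?_, ?_⟩)
    · intro u v huv
      exact Subtype.ext (Units.ext (congrArg Subtype.val huv))
    · rintro ⟨x, hx⟩
      refine ⟨⟨Units.ofPowEqOne x e hx he0, ?_⟩, rfl⟩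
      rw [MonoidHom.mem_ker, powMonoidHom_apply, Units.pow_ofPowEqOne]
  rw [← hcard, h]

lemma card_pow_eq_self {F : Type} [Field F] [Fintype F] {r : ℕ} (hr : 1 < r)
    (he : r - 1 ∣ Fintype.card F - 1) : Nat.card {x : F // x ^ r = x} = r := by
  have h := card_pow_eq_one_of_dvd he
  rw [Nat.card_eq_fintype_card, Fintype.card_subtype] at h ⊢
  have hset : Finset.univ.filter (fun x : F => x ^ r = x) =
      insert 0 (Finset.univ.filter (fun x : F => x ^ (r - 1) = 1)) := by
    ext x
    simp only [Finset.mem_filter, Finset.mem_univ, true_and, Finset.mem_insert]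
    obtain ⟨j, rfl⟩ : ∃ j, r = j + 2 := ⟨r - 2, by omega⟩
    by_cases hx : x = 0
    · simp [hx]
    · simp only [hx, false_or]
      rw [show j + 2 - 1 = j + 1 by omega, pow_succ x (j + 1), mul_eq_right₀ hx]
  rw [hset, Finset.card_insert_of_notMem, h]
  · omega
  · simp [show r - 1 ≠ 0 by omega]

variable {p : ℕ} {F : Type} [Field F]

lemma pow_pow_mul_fixed {e : ℕ} {x : F} (hx : x ^ p ^ e = x) (j : ℕ) : x ^ p ^ (e * j) = x := by
  induction j with
  | zero => simp
  | succ j ih => rw [mul_add, mul_one, pow_add, pow_mul, ih, hx]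

lemma pow_pow_dvd_fixed {e f : ℕ} (h : e ∣ f) {x : F} (hx : x ^ p ^ e = x) : x ^ p ^ f = x := by
  obtain ⟨j, rfl⟩ := h
  exact pow_pow_mul_fixed hx j

lemma pow_pow_gcd_fixed {a b : ℕ} {x : F} (ha : x ^ p ^ a = x) (hb : x ^ p ^ b = x) :
    x ^ p ^ Nat.gcd a b = x := by
  have hper : ∀ j, Function.IsPeriodicPt (fun y : F => y ^ p) j x ↔ x ^ p ^ j = x := by
    intro j
    rw [Function.IsPeriodicPt, Function.IsFixedPt, pow_iterate]
  exact (hper _).1 (((hper a).2 ha).gcd ((hper b).2 hb))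

lemma pow_pow_odd_mul {e s : ℕ} (hs : Odd s) {x : F} (hx : x ^ p ^ (2 * e) = x) :
    x ^ p ^ (e * s) = x ^ p ^ e := by
  obtain ⟨j, rfl⟩ := hs
  rw [show e * (2 * j + 1) = 2 * e * j + e by ring, pow_add, pow_mul, pow_pow_mul_fixed hx]

lemma pow_sub_one_dvd_of_dvd {e n : ℕ} (h : e ∣ n) (p : ℕ) : p ^ e - 1 ∣ p ^ n - 1 := by
  obtain ⟨j, rfl⟩ := h
  rw [pow_mul]
  simpa using Nat.sub_dvd_pow_sub_pow (p ^ e) 1 j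

lemma card_frobenius_fixed (hp : p.Prime) [Fintype F] {e n : ℕ}
    (hF : Fintype.card F = p ^ n) (he : 0 < e) (h : e ∣ n) :
    Nat.card {x : F // x ^ p ^ e = x} = p ^ e :=
  card_pow_eq_self (Nat.one_lt_pow he.ne' hp.one_lt) (hF ▸ pow_sub_one_dvd_of_dvd h p)

lemma gcd_add_two_mul {s t : ℕ} (hs : Odd s) (ht : Odd t) (hst : s.Coprime t) :
    Nat.gcd (s + t) (2 * s) = 2 := by
  obtain ⟨u, hu⟩ := hs.add_odd ht
  rw [hu, ← two_mul, Nat.gcd_mul_left]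
  have h1 : Nat.gcd u s ∣ t := by
    have : Nat.gcd u s ∣ s + t := hu ▸ (Nat.gcd_dvd_left u s).add (Nat.gcd_dvd_left u s)
    exact (Nat.dvd_add_right (Nat.gcd_dvd_right u s)).1 this
  have h2 := Nat.dvd_gcd (Nat.gcd_dvd_right u s) h1
  rw [hst.gcd_eq_one, Nat.dvd_one] at h2
  rw [h2, mul_one]

end FixedPoints

/-! ### The kernel of the polar form -/

section Kernel

variable {p : ℕ} [hp : Fact p.Prime] {F : Type} [Field F] [Algebra (ZMod p) F]

/-- The subfield of elements fixed by `x ↦ x ^ p ^ e`. -/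
def frobeniusFixed (p e : ℕ) [Fact p.Prime] (F : Type) [Field F] [Algebra (ZMod p) F] :
    Subfield F :=
  haveI := charP_of_algebra p F
  (iterateFrobenius F p e).eqLocusField (RingHom.id F)

lemma mem_frobeniusFixed {e : ℕ} {x : F} : x ∈ frobeniusFixed p e F ↔ x ^ p ^ e = x := by
  have := charP_of_algebra p F
  exact RingHom.mem_eqLocusField

/-- The radical of the polar form is a space over the subfield of size `p ^ (2 * d)`. -/
def radical (p d s t : ℕ) [Fact p.Prime] (F : Type) [Field F] [Algebra (ZMod p) F]
    (α β : F) (hs : Odd s) (ht : Odd t) (hts : t ≤ 2 * s) :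
    Submodule (frobeniusFixed p (2 * d) F) F where
  carrier := {x | phiMap p (d * s) (2 * (d * s)) (d * t) α β x = 0}
  zero_mem' := phiMap_zero ..
  add_mem' {x y} hx hy := by
    have := charP_of_algebra p F
    have hadd : phiMap p (d * s) (2 * (d * s)) (d * t) α β (x + y) =
        phiMap p (d * s) (2 * (d * s)) (d * t) α β x +
          phiMap p (d * s) (2 * (d * s)) (d * t) α β y := by
      simp only [phiMap, add_pow_char_pow]
      ring
    rw [Set.mem_ofPred_eq] at hx hy ⊢
    rw [hadd, hx, hy, add_zero]
  smul_mem' c x hx := by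
    have hc := mem_frobeniusFixed.1 c.2
    have hexp : 2 * (d * s) - d * t = d * (2 * s - t) := by
      rw [Nat.mul_sub]; ring_nf
    have hodd : Odd (2 * s - t) := Nat.Even.sub_odd hts (even_two_mul s) ht
    have hmul : phiMap p (d * s) (2 * (d * s)) (d * t) α β (c * x) =
        (c : F) ^ p ^ d * phiMap p (d * s) (2 * (d * s)) (d * t) α β x := by
      simp only [phiMap, hexp, mul_pow, pow_pow_odd_mul hs hc, pow_pow_odd_mul ht hc,
        pow_pow_odd_mul hodd hc]
      ring
    rw [Set.mem_ofPred_eq] at hx ⊢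
    rw [Algebra.smul_def]
    exact hmul.trans (by rw [hx, mul_zero])

/-- The solutions of a nontrivial linear equation `a x + b ρ(x) + c ρ²(x) = 0`, where `ρ` is an
automorphism, form a set of size at most the square of the size of the fixed field of `ρ`. -/
lemma card_kernel_le {F : Type} [Field F] [Fintype F] (ρ : F →+* F) {a b c : F}
    (hne : ¬(a = 0 ∧ b = 0 ∧ c = 0)) :
    Nat.card {x : F // a * x + b * ρ x + c * ρ (ρ x) = 0} ≤ Nat.card {x : F // ρ x = x} ^ 2 := by
  have hρ : Function.Injective ρ := ρ.injective
  simp only [Nat.card_eq_fintype_card, Fintype.card_subtype]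
  set W := Finset.univ.filter (fun x : F => a * x + b * ρ x + c * ρ (ρ x) = 0) with hW
  set E := Finset.univ.filter (fun x : F => ρ x = x) with hE
  have hEpos : 0 < E.card := Finset.card_pos.2 ⟨0, by simp [hE]⟩
  by_cases hx : ∃ x₀ ∈ W, x₀ ≠ 0
  swap
  · push Not at hx
    have : W ⊆ {0} := fun x hxW => Finset.mem_singleton.2 (hx x hxW)
    exact (Finset.card_le_card this).trans (by simpa using Nat.one_le_pow _ _ hEpos)
  obtain ⟨x₀, hx₀W, hx₀⟩ := hx
  have hx₀' : ρ x₀ ≠ 0 := (map_ne_zero ρ).2 hx₀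
  have hx₀'' : ρ (ρ x₀) ≠ 0 := (map_ne_zero ρ).2 hx₀'
  have h0 : a * x₀ + b * ρ x₀ + c * ρ (ρ x₀) = 0 := by simpa [hW] using hx₀W
  set B := Finset.univ.filter (fun v : F => c * ρ (ρ x₀) * ρ v = a * x₀ * v) with hB
  set D : F → F := fun x => ρ (x / x₀) - x / x₀ with hD
  have hDB : ∀ x ∈ W, D x ∈ B := by
    intro x hxW
    have h1 : a * x + b * ρ x + c * ρ (ρ x) = 0 := by simpa [hW] using hxW
    obtain ⟨u, rfl⟩ : ∃ u, x = u * x₀ := ⟨x / x₀, (div_mul_cancel₀ x hx₀).symm⟩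
    simp only [hB, hD, Finset.mem_filter, Finset.mem_univ, true_and, mul_div_cancel_right₀ _ hx₀,
      map_sub]
    rw [map_mul, map_mul] at h1
    linear_combination h1 - ρ u * h0
  have hfib : ∀ v ∈ B, (W.filter (fun x => D x = v)).card ≤ E.card := by
    intro v _
    by_cases hne : (W.filter (fun x => D x = v)).Nonempty
    swap
    · rw [Finset.not_nonempty_iff_eq_empty.1 hne]; simp
    obtain ⟨y, hy⟩ := hne
    refine Finset.card_le_card_of_injOn (fun x => x / x₀ - y / x₀) ?_ ?_
    · intro x hx
      have hx' := (Finset.mem_filter.1 hx).2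
      have hy' := (Finset.mem_filter.1 hy).2
      simp only [hE, Finset.coe_filter, Finset.mem_univ, true_and, Set.mem_ofPred_eq, map_sub]
      simp only [hD] at hx' hy'
      linear_combination hx' - hy'
    · intro x _ x' _ hxx'
      exact (div_left_inj' hx₀).1 (sub_left_inj.1 hxx')
  have hBcard : B.card ≤ E.card := by
    by_cases hv : ∃ v₀ ∈ B, v₀ ≠ 0
    swap
    · push Not at hv
      have : B ⊆ {0} := fun x hxB => Finset.mem_singleton.2 (hv x hxB)
      exact (Finset.card_le_card this).trans (by simpa using hEpos)
    obtain ⟨v₀, hv₀B, hv₀⟩ := hv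
    have hv₀' : ρ v₀ ≠ 0 := (map_ne_zero ρ).2 hv₀
    have hv₀B' : c * ρ (ρ x₀) * ρ v₀ = a * x₀ * v₀ := by simpa [hB] using hv₀B
    have hc : c ≠ 0 := by
      rintro rfl
      have ha : a = 0 := by simpa [hx₀, hv₀] using hv₀B'.symm
      refine hne ⟨ha, ?_, rfl⟩
      simpa [ha, hx₀'] using h0
    refine Finset.card_le_card_of_injOn (fun v => v / v₀) ?_ ?_
    · intro v hv
      have hv' : c * ρ (ρ x₀) * ρ v = a * x₀ * v := by simpa [hB] using hv
      simp only [hE, Finset.coe_filter, Finset.mem_univ, true_and, Set.mem_ofPred_eq, map_div₀]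
      rw [div_eq_div_iff hv₀' hv₀]
      apply mul_left_cancel₀ (mul_ne_zero hc hx₀'')
      linear_combination v₀ * hv' - v * hv₀B'
    · intro x _ x' _ hxx'
      exact (div_left_inj' hv₀).1 hxx'
  calc W.card ≤ E.card * B.card := Finset.card_le_mul_card_image_of_maps_to hDB _ hfib
    _ ≤ E.card * E.card := Nat.mul_le_mul_left _ hBcard
    _ = E.card ^ 2 := (sq _).symm

lemma exists_card_radical_eq [Fintype F] {d s t : ℕ} {α β : F} (hd : 0 < d) (hs : Odd s)
    (ht : Odd t) (hst : s.Coprime t) (hts : t ≤ 2 * s)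
    (hF : Fintype.card F = p ^ (2 * (d * s))) (hne : ¬(α = 0 ∧ β = 0)) :
    ∃ r ≤ 2, Nat.card {x : F // phiMap p (d * s) (2 * (d * s)) (d * t) α β x = 0} =
      p ^ (2 * d * r) := by
  have := charP_of_algebra p F
  have hcardE : Nat.card (frobeniusFixed p (2 * d) F) = p ^ (2 * d) := by
    rw [← card_frobenius_fixed (F := F) hp.out hF (by omega : 0 < 2 * d) ⟨s, by ring⟩]
    exact Nat.card_congr (Equiv.subtypeEquivRight fun x => mem_frobeniusFixed)
  have hcard := Module.natCard_eq_pow_finrank (K := frobeniusFixed p (2 * d) F)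
    (V := radical p d s t F α β hs ht hts)
  rw [hcardE, ← pow_mul] at hcard
  refine ⟨_, ?_, hcard⟩
  set ρ := iterateFrobenius F p (d * s + d * t) with hρ
  have hρ2 : ∀ x : F, ρ (ρ x) = x ^ p ^ (2 * (d * t)) := fun x => by
    rw [hρ, iterateFrobenius_def, iterateFrobenius_def, ← pow_mul, ← pow_add,
      show d * s + d * t + (d * s + d * t) = 2 * (d * s) + 2 * (d * t) by ring, pow_add, pow_mul,
      pow_card_pow hF]
  have hfix : Nat.card {x : F // ρ x = x} = p ^ (2 * d) := by
    rw [← card_frobenius_fixed (F := F) hp.out hF (by omega : 0 < 2 * d) ⟨s, by ring⟩]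
    refine Nat.card_congr (Equiv.subtypeEquivRight fun x => ?_)
    rw [hρ, iterateFrobenius_def]
    constructor
    · intro h
      have h1 := pow_pow_gcd_fixed h (pow_card_pow hF x)
      rwa [← mul_add, ← mul_assoc, mul_comm 2 d, mul_assoc, Nat.gcd_mul_left,
        gcd_add_two_mul hs ht hst, mul_comm d 2] at h1
    · intro h
      refine pow_pow_dvd_fixed ?_ h
      obtain ⟨u, hu⟩ := hs.add_odd ht
      exact ⟨u, by rw [← mul_add, hu]; ring⟩
  have hsub : Nat.card {x : F // phiMap p (d * s) (2 * (d * s)) (d * t) α β x = 0} ≤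
      Nat.card {x : F // β * x + α ^ p ^ (d * t) * ρ x + β ^ p ^ (d * t) * ρ (ρ x) = 0} := by
    refine Nat.card_mono (Set.toFinite _) fun x hx => ?_
    have hx' : phiMap p (d * s) (2 * (d * s)) (d * t) α β x = 0 := hx
    have hz : phiMap p (d * s) (2 * (d * s)) (d * t) α β x ^ p ^ (d * t) = 0 := by
      rw [hx', zero_pow (pow_ne_zero _ hp.out.ne_zero)]
    have hle : d * t ≤ 2 * (d * s) := by nlinarith
    have hcancel : ∀ y : F, (y ^ p ^ (2 * (d * s) - d * t)) ^ p ^ (d * t) = y := fun y => by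
      rw [← pow_mul, ← pow_add, Nat.sub_add_cancel hle, pow_card_pow hF]
    rw [phiMap, add_pow_char_pow, add_pow_char_pow, mul_pow, mul_pow, mul_pow, hcancel, hcancel,
      ← pow_mul, ← pow_add, ← pow_mul x, ← pow_add, ← two_mul] at hz
    change β * x + α ^ p ^ (d * t) * ρ x + β ^ p ^ (d * t) * ρ (ρ x) = 0
    rw [hρ2, hρ, iterateFrobenius_def]
    linear_combination hz
  have hbound := hsub.trans (card_kernel_le ρ (a := β) (b := α ^ p ^ (d * t))
    (c := β ^ p ^ (d * t)) fun h => hne ⟨pow_eq_zero_iff (pow_ne_zero _ hp.out.ne_zero) |>.1 h.2.1,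
      h.1⟩)
  rw [hfix, ← pow_mul] at hbound
  have h3 := (Nat.pow_le_pow_iff_right hp.out.one_lt).1 (hcard.symm.le.trans hbound)
  exact Nat.le_of_mul_le_mul_left h3 (by omega)

end Kernel

/-! ### Integrality and sign of the exponential sum -/

section Integrality

variable {p : ℕ} [hp : Fact p.Prime] {F : Type} [Field F] [Fintype F] [Algebra (ZMod p) F]

lemma dvd_card_of_mul_closed {F : Type} [Field F] [Fintype F] {e : ℕ}
    (he : e ∣ Fintype.card F - 1) (S : Finset F) (h0 : (0 : F) ∉ S)
    (hS : ∀ c : F, c ^ e = 1 → ∀ x ∈ S, c * x ∈ S) : e ∣ S.card := by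
  rw [Finset.card_eq_sum_card_image (fun x : F => x ^ e) S]
  refine Finset.dvd_sum fun b hb => ?_
  obtain ⟨x₀, hx₀, rfl⟩ := Finset.mem_image.1 hb
  have hne : x₀ ≠ 0 := fun h => h0 (h ▸ hx₀)
  have hmu := card_pow_eq_one_of_dvd he
  rw [Nat.card_eq_fintype_card, Fintype.card_subtype] at hmu
  have hfib : S.filter (fun x => x ^ e = x₀ ^ e) =
      (Finset.univ.filter (fun c : F => c ^ e = 1)).image (fun c => c * x₀) := by
    ext x
    simp only [Finset.mem_filter, Finset.mem_image, Finset.mem_univ, true_and]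
    constructor
    · rintro ⟨_, hx⟩
      exact ⟨x / x₀, by rw [div_pow, hx, div_self (pow_ne_zero _ hne)], div_mul_cancel₀ x hne⟩
    · rintro ⟨c, hc, rfl⟩
      exact ⟨hS c hc x₀ hx₀, by rw [mul_pow, hc, one_mul]⟩
  rw [hfib, Finset.card_image_of_injective _ (mul_left_injective₀ hne), hmu]

lemma quadFun_mul {p : ℕ} {F : Type} [Field F]
    {d s t : ℕ} (hs : Odd s) (ht : Odd t) {c : F} (hc : c ^ p ^ (2 * d) = c)
    (α β x : F) :
    quadFun p (d * s) (d * t) α β (c * x) =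
      c ^ (p ^ d + 1) * quadFun p (d * s) (d * t) α β x := by
  simp only [quadFun, mul_pow, pow_succ, pow_pow_odd_mul hs hc, pow_pow_odd_mul ht hc]
  ring

lemma sq_sub_one_eq (Q : ℕ) : Q ^ 2 - 1 = (Q + 1) * (Q - 1) := by
  have := Nat.sq_sub_sq Q 1
  simpa using this

lemma exists_pow_add_one_eq_algebraMap {d s : ℕ} (hF : Fintype.card F = p ^ (2 * (d * s)))
    {a : ZMod p} (ha : a ≠ 0) :
    ∃ c : F, c ≠ 0 ∧ c ^ p ^ (2 * d) = c ∧ c ^ (p ^ d + 1) = algebraMap (ZMod p) F a := by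
  obtain ⟨G, hG⟩ := pow_sub_one_dvd_of_dvd (⟨s, by ring⟩ : 2 * d ∣ 2 * (d * s)) p
  have hQ : p ^ (2 * d) - 1 = (p ^ d + 1) * (p ^ d - 1) := by
    rw [mul_comm 2 d, pow_mul, sq_sub_one_eq]
  have hN : Nat.card Fˣ = (p ^ d + 1) * ((p ^ d - 1) * G) := by
    rw [Nat.card_units, Nat.card_eq_fintype_card, hF, hG, hQ, mul_assoc]
  have hpos : 0 < p ^ d := pow_pos hp.out.pos d
  have ha' : algebraMap (ZMod p) F a ≠ 0 := by simpa using ha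
  have ha1 : algebraMap (ZMod p) F a ^ (p ^ d - 1) = 1 := by
    apply mul_right_cancel₀ ha'
    rw [← pow_succ, Nat.sub_add_cancel hpos, one_mul, ← map_pow, ZMod.pow_card_pow]
  obtain ⟨c, hc⟩ := exists_pow_eq_of_pow_eq_one (G := Fˣ) (e := p ^ d + 1)
    (a := Units.mk0 _ ha') ⟨_, hN⟩ (by
      rw [hN, Nat.mul_div_cancel_left _ (by omega), pow_mul]
      ext
      rw [Units.val_pow_eq_pow_val, Units.val_pow_eq_pow_val, Units.val_mk0, ha1, one_pow,
        Units.val_one])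
  have hc' : (c : F) ^ (p ^ d + 1) = algebraMap (ZMod p) F a := by
    rw [← Units.val_pow_eq_pow_val, hc, Units.val_mk0]
  refine ⟨c, c.ne_zero, ?_, hc'⟩
  have : p ^ (2 * d) = (p ^ d + 1) * (p ^ d - 1) + 1 := by
    rw [← hQ, Nat.sub_add_cancel (pow_pos hp.out.pos _)]
  rw [this, pow_succ, pow_mul, hc', ha1, one_mul]

lemma exists_int_sum_quadFun {d s t : ℕ} (hs : Odd s) (ht : Odd t)
    (hF : Fintype.card F = p ^ (2 * (d * s))) (α β : F) :
    ∃ z : ℤ, ∑ x : F, traceChar p F (quadFun p (d * s) (d * t) α β x) = (z : ℂ) ∧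
      ((p : ℤ) ^ d + 1) ∣ z - 1 := by
  set h : F → ZMod p := fun x => Algebra.trace (ZMod p) F (quadFun p (d * s) (d * t) α β x) with hh
  set N : ZMod p → ℕ := fun b => (Finset.univ.filter (fun x => h x = b)).card with hN
  have hquad0 : h 0 = 0 := by simp [hh, quadFun]
  have hscale : ∀ c : F, c ^ p ^ (2 * d) = c → ∀ a : ZMod p,
      c ^ (p ^ d + 1) = algebraMap (ZMod p) F a → ∀ x, h (c * x) = a * h x := by
    intro c hc a ha x
    simp only [hh]
    rw [quadFun_mul hs ht hc, ha, ← Algebra.smul_def, map_smul, smul_eq_mul]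
  have hNeq : ∀ a : ZMod p, a ≠ 0 → N a = N 1 := by
    intro a ha
    obtain ⟨c, hc0, hc, hca⟩ := exists_pow_add_one_eq_algebraMap (F := F) hF ha
    simp only [hN]
    have : Finset.univ.filter (fun x => h x = a) =
        (Finset.univ.filter (fun x => h x = 1)).image (fun x => c * x) := by
      ext x
      simp only [Finset.mem_filter, Finset.mem_image, Finset.mem_univ, true_and]
      constructor
      · intro hx
        refine ⟨x / c, ?_, mul_div_cancel₀ x hc0⟩
        have := hscale c hc a hca (x / c)
        rw [mul_div_cancel₀ x hc0, hx] at this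
        exact mul_left_cancel₀ ha (by rw [← this, mul_one])
      · rintro ⟨y, hy, rfl⟩
        rw [hscale c hc a hca, hy, mul_one]
    rw [this, Finset.card_image_of_injective _ (mul_right_injective₀ hc0)]
  have hdiv : p ^ d + 1 ∣ Fintype.card F - 1 := by
    rw [hF]
    refine dvd_trans ?_ (pow_sub_one_dvd_of_dvd (⟨s, by ring⟩ : 2 * d ∣ 2 * (d * s)) p)
    rw [mul_comm 2 d, pow_mul, sq_sub_one_eq]
    exact dvd_mul_right _ _
  have hinv : ∀ c : F, c ^ (p ^ d + 1) = 1 → c ≠ 0 ∧ ∀ x, h (c * x) = h x := by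
    intro c hc
    have hc0 : c ≠ 0 := by
      rintro rfl
      simp at hc
    refine ⟨hc0, fun x => ?_⟩
    have hfix : c ^ p ^ (2 * d) = c := by
      have : p ^ (2 * d) = (p ^ d + 1) * (p ^ d - 1) + 1 := by
        rw [← sq_sub_one_eq, ← pow_mul, mul_comm d 2, Nat.sub_add_cancel (pow_pos hp.out.pos _)]
      rw [this, pow_succ, pow_mul, hc, one_pow, one_mul]
    rw [hscale c hfix 1 (by rw [hc, map_one]), one_mul]
  have hN1 : p ^ d + 1 ∣ N 1 := by
    refine dvd_card_of_mul_closed hdiv _ ?_ fun c hc x hx => ?_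
    · simp [hquad0]
    · simpa [(hinv c hc).2 x] using hx
  have hN0 : ∃ w, N 0 = (p ^ d + 1) * w + 1 := by
    obtain ⟨w, hw⟩ : p ^ d + 1 ∣ ((Finset.univ.filter (fun x => h x = 0)).erase 0).card := by
      refine dvd_card_of_mul_closed hdiv _ (by simp) fun c hc x hx => ?_
      simpa [(hinv c hc).2 x, (hinv c hc).1] using hx
    refine ⟨w, ?_⟩
    rw [← hw, Finset.card_erase_add_one (by simp [hquad0])]
  obtain ⟨w, hw⟩ := hN0
  obtain ⟨v, hv⟩ := hN1
  refine ⟨(N 0 : ℤ) - N 1, ?_, w - v, by rw [hw, hv]; push_cast; ring⟩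
  have hsum0 : ∑ b : ZMod p, ZMod.stdAddChar b = 0 := by
    refine AddChar.sum_eq_zero_of_ne_one fun hone => ?_
    have := ZMod.injective_stdAddChar (N := p) (a₁ := 1) (a₂ := 0) (by rw [hone]; rfl)
    exact one_ne_zero this
  have hfiber : ∑ x : F, traceChar p F (quadFun p (d * s) (d * t) α β x) =
      ∑ b : ZMod p, (N b : ℂ) * ZMod.stdAddChar b := by
    rw [← Finset.sum_fiberwise _ h]
    refine Finset.sum_congr rfl fun b _ => ?_
    rw [Finset.sum_congr rfl (g := fun _ => ZMod.stdAddChar b), Finset.sum_const, nsmul_eq_mul]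
    intro x hx
    rw [traceChar_apply]
    exact congrArg _ (Finset.mem_filter.1 hx).2
  have hterm : ∀ b : ZMod p, (N b : ℂ) * ZMod.stdAddChar b =
      (N 1 : ℂ) * ZMod.stdAddChar b + if b = 0 then (N 0 : ℂ) - N 1 else 0 := by
    intro b
    split_ifs with hb
    · rw [hb, AddChar.map_zero_eq_one]; ring
    · rw [hNeq b hb, add_zero]
  rw [hfiber, Finset.sum_congr rfl fun b _ => hterm b, Finset.sum_add_distrib, ← Finset.mul_sum,
    hsum0, Finset.sum_ite_eq' Finset.univ (0 : ZMod p)]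
  simp

/-- An integer congruent to `1` modulo `Q + 1` whose square is `Q ^ (2 * j)` is `(-Q) ^ j`. -/
lemma eq_neg_pow_of_sq_eq {Q z : ℤ} (hQ : 2 ≤ Q) {j : ℕ} (hz : Q + 1 ∣ z - 1)
    (hsq : z ^ 2 = Q ^ (2 * j)) : z = (-Q) ^ j := by
  have h1 : Q + 1 ∣ (-Q) ^ j - 1 := by
    have h2 := sub_dvd_pow_sub_pow (-Q) 1 j
    rw [one_pow] at h2
    exact dvd_trans ⟨-1, by ring⟩ h2
  have h3 : z ^ 2 = ((-Q) ^ j) ^ 2 := by rw [hsq, ← pow_mul, mul_comm j 2, pow_mul, pow_mul, neg_sq]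
  rcases sq_eq_sq_iff_eq_or_eq_neg.1 h3 with h | h
  · exact h
  · exfalso
    have h4 : Q + 1 ∣ 2 := by
      have := dvd_add hz h1
      rw [h] at this
      exact (dvd_neg.1 (by convert this using 1; ring))
    have := Int.le_of_dvd (by norm_num) h4
    omega

lemma exists_sum_quadFun_eq {d s t : ℕ} {α β : F} (hodd : p % 2 = 1) (hd : 0 < d) (hs : Odd s)
    (ht : Odd t) (hst : s.Coprime t) (hts : t ≤ 2 * s)
    (hF : Fintype.card F = p ^ (2 * (d * s))) (hα : α ^ p ^ (d * s) = α)
    (hne : ¬(α = 0 ∧ β = 0)) :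
    ∃ r ≤ 2, ∑ x : F, traceChar p F (quadFun p (d * s) (d * t) α β x) =
      (-(p : ℂ) ^ d) ^ (s + r) := by
  obtain ⟨r, hr, hcard⟩ := exists_card_radical_eq hd hs ht hst hts hF hne
  obtain ⟨z, hz, hzd⟩ := exists_int_sum_quadFun hs ht hF α β
  have hk : d * t ≤ 2 * (d * s) := by nlinarith
  have hnorm := normSq_sum_quadFun (β := β) hodd hF hk hα
  rw [hz, hcard, map_intCast] at hnorm
  refine ⟨r, hr, ?_⟩
  have hsq : z ^ 2 = ((p : ℤ) ^ d) ^ (2 * (s + r)) := by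
    have : z * z = (p : ℤ) ^ (2 * (d * s)) * ((p ^ (2 * d * r) : ℕ) : ℤ) := by exact_mod_cast hnorm
    rw [sq, this]
    push_cast
    ring
  have hQ : (2 : ℤ) ≤ (p : ℤ) ^ d := by
    exact_mod_cast hp.out.two_le.trans (Nat.le_self_pow hd.ne' p)
  rw [hz, eq_neg_pow_of_sq_eq hQ hzd hsq]
  push_cast
  rfl

end Integrality

/-! ### Power moments and the value distribution -/

section Moments

variable {p : ℕ} [hp : Fact p.Prime] {F : Type} [Field F] [Fintype F] [Algebra (ZMod p) F]

/-- The set of pairs `(α, β)` with `α` in the subfield of size `p ^ m`. -/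
def coeffPairs (p m : ℕ) (F : Type) [Field F] [Fintype F] : Finset (F × F) :=
  (Finset.univ.filter fun α : F => α ^ p ^ m = α) ×ˢ Finset.univ

lemma mem_coeffPairs {p : ℕ} {F : Type} [Field F] [Fintype F]
    {m : ℕ} {ab : F × F} :
    ab ∈ coeffPairs p m F ↔ ab.1 ^ p ^ m = ab.1 := by
  simp [coeffPairs]

lemma card_filter_pow_eq {p : ℕ} [hp : Fact p.Prime] {F : Type} [Field F] [Fintype F]
    {m : ℕ} (hm : 0 < m) (hF : Fintype.card F = p ^ (2 * m)) :
    (Finset.univ.filter fun α : F => α ^ p ^ m = α).card = p ^ m := by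
  have h := card_frobenius_fixed (F := F) hp.out hF hm ⟨2, by ring⟩
  rwa [Nat.card_eq_fintype_card, Fintype.card_subtype] at h

lemma card_coeffPairs {p : ℕ} [Fact p.Prime] {F : Type} [Field F] [Fintype F]
    {m : ℕ} (hm : 0 < m) (hF : Fintype.card F = p ^ (2 * m)) :
    (coeffPairs p m F).card = p ^ (3 * m) := by
  rw [coeffPairs, Finset.card_product, card_filter_pow_eq hm hF, Finset.card_univ, hF]
  ring

lemma sum_subfield_traceChar {m : ℕ} (hodd : p % 2 = 1) (hm : 0 < m)
    (hF : Fintype.card F = p ^ (2 * m)) {u : F} (hu : u ^ p ^ m = u) :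
    ∑ α ∈ Finset.univ.filter (fun α : F => α ^ p ^ m = α), traceChar p F (α / 2 * u) =
      if u = 0 then (p : ℂ) ^ m else 0 := by
  have := charP_of_algebra p F
  have h2 := two_ne_zero_of_odd (p := p) (F := F) hodd
  split_ifs with h0
  · simp [h0, card_filter_pow_eq hm hF]
  · have : NeZero (2 : F) := ⟨h2⟩
    obtain ⟨y, hy⟩ : ∃ y, traceChar p F y ≠ 1 := by
      by_contra! h
      refine traceChar_isPrimitive (p := p) (F := F) one_ne_zero ?_
      ext y
      simp [h]
    set c := (y + y ^ p ^ m) / u with hc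
    have hcK : c ^ p ^ m = c := by
      rw [hc, div_pow, hu, add_pow_char_pow, ← pow_mul, ← pow_add, ← two_mul, pow_card_pow hF,
        add_comm]
    have hχ : traceChar p F (c / 2 * u) = traceChar p F y := by
      have hcu : c / 2 * u = y / 2 + (y / 2) ^ p ^ m := by
        rw [hc, div_pow, two_pow_char_pow]
        field_simp
      rw [hcu, AddChar.map_add_eq_mul, traceChar_pow_char_pow, ← AddChar.map_add_eq_mul,
        add_halves]
    have hshift : ∑ α ∈ Finset.univ.filter (fun α : F => α ^ p ^ m = α),
        traceChar p F (α / 2 * u) = ∑ α ∈ Finset.univ.filter (fun α : F => α ^ p ^ m = α),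
          traceChar p F y * traceChar p F (α / 2 * u) := by
      refine (Finset.sum_equiv (Equiv.addRight c) (fun α => ?_) fun α _ => ?_).symm
      · simp [add_pow_char_pow, hcK]
      · rw [← hχ, ← AddChar.map_add_eq_mul, Equiv.coe_addRight]
        congr 1
        ring
    rw [← Finset.mul_sum] at hshift
    by_contra hS
    exact hy (mul_right_cancel₀ hS (by rw [← hshift, one_mul]))

lemma sum_coeffPairs_traceChar {m : ℕ} (hodd : p % 2 = 1) (hm : 0 < m)
    (hF : Fintype.card F = p ^ (2 * m)) {u : F} (hu : u ^ p ^ m = u) (v : F) :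
    ∑ ab ∈ coeffPairs p m F, traceChar p F (ab.1 / 2 * u + ab.2 * v) =
      if u = 0 ∧ v = 0 then (p : ℂ) ^ (3 * m) else 0 := by
  rw [coeffPairs, Finset.sum_product]
  simp only [AddChar.map_add_eq_mul]
  rw [← Finset.sum_mul_sum, sum_subfield_traceChar hodd hm hF hu,
    AddChar.sum_mulShift _ traceChar_isPrimitive, hF]
  split_ifs <;> simp_all
  ring

lemma first_moment {m k : ℕ} (hodd : p % 2 = 1) (hm : 0 < m)
    (hF : Fintype.card F = p ^ (2 * m)) :
    ∑ ab ∈ coeffPairs p m F, ∑ x : F, traceChar p F (quadFun p m k ab.1 ab.2 x) =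
      (p : ℂ) ^ (3 * m) := by
  rw [Finset.sum_comm]
  have h : ∀ x : F, ∑ ab ∈ coeffPairs p m F, traceChar p F (quadFun p m k ab.1 ab.2 x) =
      if x = 0 then (p : ℂ) ^ (3 * m) else 0 := by
    intro x
    simp only [quadFun]
    rw [sum_coeffPairs_traceChar hodd hm hF (pow_norm_fixed hF x)]
    simp
  rw [Finset.sum_congr rfl fun x _ => h x, Finset.sum_ite_eq' Finset.univ (0 : F)]
  simp

lemma second_moment {m k : ℕ} (hodd : p % 2 = 1) (hm : 0 < m)
    (hF : Fintype.card F = p ^ (2 * m)) :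
    ∑ ab ∈ coeffPairs p m F, (∑ x : F, traceChar p F (quadFun p m k ab.1 ab.2 x)) *
        starRingEnd ℂ (∑ x : F, traceChar p F (quadFun p m k ab.1 ab.2 x)) =
      (p : ℂ) ^ (3 * m) * ((Finset.univ.filter fun xy : F × F =>
        xy.1 ^ (p ^ m + 1) = xy.2 ^ (p ^ m + 1) ∧
          xy.1 ^ (p ^ k + 1) = xy.2 ^ (p ^ k + 1)).card : ℂ) := by
  have := charP_of_algebra p F
  have h : ∀ xy : F × F, ∑ ab ∈ coeffPairs p m F, traceChar p F (quadFun p m k ab.1 ab.2 xy.1) *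
      starRingEnd ℂ (traceChar p F (quadFun p m k ab.1 ab.2 xy.2)) =
      if xy.1 ^ (p ^ m + 1) = xy.2 ^ (p ^ m + 1) ∧ xy.1 ^ (p ^ k + 1) = xy.2 ^ (p ^ k + 1)
        then (p : ℂ) ^ (3 * m) else 0 := by
    intro xy
    have hsum := sum_coeffPairs_traceChar hodd hm hF
      (u := xy.1 ^ (p ^ m + 1) - xy.2 ^ (p ^ m + 1))
      (by rw [sub_pow_char_pow, pow_norm_fixed hF, pow_norm_fixed hF])
      (xy.1 ^ (p ^ k + 1) - xy.2 ^ (p ^ k + 1))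
    simp only [sub_eq_zero] at hsum
    rw [← hsum]
    refine Finset.sum_congr rfl fun ab _ => ?_
    rw [traceChar_starRingEnd, ← AddChar.map_add_eq_mul]
    congr 1
    simp only [quadFun]
    ring
  calc _ = ∑ ab ∈ coeffPairs p m F, ∑ xy : F × F,
        traceChar p F (quadFun p m k ab.1 ab.2 xy.1) *
          starRingEnd ℂ (traceChar p F (quadFun p m k ab.1 ab.2 xy.2)) := by
        refine Finset.sum_congr rfl fun ab _ => ?_
        rw [map_sum, Finset.sum_mul_sum, Fintype.sum_prod_type]
    _ = _ := by
        rw [Finset.sum_comm, Finset.sum_congr rfl fun xy _ => h xy, ← Finset.sum_filter,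
          Finset.sum_const, nsmul_eq_mul, mul_comm]

lemma pow_add_one_eq_one_iff {p d s t : ℕ} {F : Type} [Field F] (hs : Odd s)
    (ht : Odd t) (hst : s.Coprime t) (c : F) :
    c ^ (p ^ (d * s) + 1) = 1 ∧ c ^ (p ^ (d * t) + 1) = 1 ↔ c ^ (p ^ d + 1) = 1 := by
  constructor
  · rintro ⟨h1, h2⟩
    have hfix : ∀ j, c ^ (p ^ j + 1) = 1 → c ^ p ^ (2 * j) = c := by
      intro j hj
      have hc0 : c ≠ 0 := by rintro rfl; simp at hj
      have hinv : c ^ p ^ j = c⁻¹ := eq_inv_of_mul_eq_one_left (by rw [← pow_succ, hj])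
      rw [two_mul, pow_add, pow_mul, hinv, inv_pow, hinv, inv_inv]
    have h3 := pow_pow_gcd_fixed (hfix _ h1) (hfix _ h2)
    rw [Nat.gcd_mul_left, Nat.gcd_mul_left, hst.gcd_eq_one, mul_one] at h3
    rw [pow_succ, ← pow_pow_odd_mul hs h3, ← pow_succ, h1]
  · intro h
    have hdvd : ∀ j, Odd j → c ^ (p ^ (d * j) + 1) = 1 := by
      intro j hj
      have hd : p ^ d + 1 ∣ p ^ (d * j) + 1 := by
        rw [pow_mul]
        simpa using hj.nat_add_dvd_pow_add_pow (p ^ d) 1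
      obtain ⟨w, hw⟩ := hd
      rw [hw, pow_mul, h, one_pow]
    exact ⟨hdvd s hs, hdvd t ht⟩

lemma card_equal_powers {p : ℕ} {F : Type} [Field F] [Fintype F]
    {d s t : ℕ} (hs : Odd s) (ht : Odd t) (hst : s.Coprime t)
    (hF : Fintype.card F = p ^ (2 * (d * s))) :
    (Finset.univ.filter fun xy : F × F =>
        xy.1 ^ (p ^ (d * s) + 1) = xy.2 ^ (p ^ (d * s) + 1) ∧
          xy.1 ^ (p ^ (d * t) + 1) = xy.2 ^ (p ^ (d * t) + 1)).card =
      1 + (p ^ (2 * (d * s)) - 1) * (p ^ d + 1) := by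
  have hdiv : p ^ d + 1 ∣ Fintype.card F - 1 := by
    rw [hF]
    refine dvd_trans ?_ (pow_sub_one_dvd_of_dvd (⟨s, by ring⟩ : 2 * d ∣ 2 * (d * s)) p)
    rw [mul_comm 2 d, pow_mul, sq_sub_one_eq]
    exact dvd_mul_right _ _
  have hmu := card_pow_eq_one_of_dvd hdiv
  rw [Nat.card_eq_fintype_card, Fintype.card_subtype] at hmu
  set μ := Finset.univ.filter (fun c : F => c ^ (p ^ d + 1) = 1) with hμ
  set U := Finset.univ.erase (0 : F) with hU
  have hset : (Finset.univ.filter fun xy : F × F =>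
        xy.1 ^ (p ^ (d * s) + 1) = xy.2 ^ (p ^ (d * s) + 1) ∧
          xy.1 ^ (p ^ (d * t) + 1) = xy.2 ^ (p ^ (d * t) + 1)) =
      insert (0, 0) ((U ×ˢ μ).image fun yc => (yc.2 * yc.1, yc.1)) := by
    ext ⟨x, y⟩
    simp only [Finset.mem_filter, Finset.mem_univ, true_and, Finset.mem_insert, Finset.mem_image,
      Finset.mem_product, Prod.exists, Prod.mk.injEq, hU, hμ, Finset.mem_erase, and_true]
    constructor
    · rintro ⟨h1, h2⟩
      by_cases hy : y = 0
      · subst hy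
        rw [zero_pow (by omega), pow_eq_zero_iff (by omega)] at h1
        exact Or.inl ⟨h1, rfl⟩
      · refine Or.inr ⟨y, x / y, ⟨hy, ?_⟩, div_mul_cancel₀ x hy, rfl⟩
        rw [← pow_add_one_eq_one_iff hs ht hst, div_pow, div_pow, h1, h2,
          div_self (pow_ne_zero _ hy), div_self (pow_ne_zero _ hy)]
        exact ⟨rfl, rfl⟩
    · rintro (⟨rfl, rfl⟩ | ⟨y', c, ⟨hy, hc⟩, rfl, rfl⟩)
      · exact ⟨rfl, rfl⟩
      · obtain ⟨h1, h2⟩ := (pow_add_one_eq_one_iff hs ht hst c).2 hc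
        rw [mul_pow, mul_pow, h1, h2, one_mul, one_mul]
        exact ⟨rfl, rfl⟩
  have hinj : Set.InjOn (fun yc : F × F => (yc.2 * yc.1, yc.1)) (U ×ˢ μ : Finset (F × F)) := by
    rintro ⟨y, c⟩ hy ⟨y', c'⟩ _ h
    have hy0 : y ≠ 0 := by
      have := (Finset.mem_product.1 (Finset.mem_coe.1 hy)).1
      exact (Finset.mem_erase.1 this).1
    simp only [Prod.mk.injEq] at h
    obtain ⟨h1, rfl⟩ := h
    rw [mul_right_cancel₀ hy0 h1]
  rw [hset, Finset.card_insert_of_notMem, Finset.card_image_of_injOn hinj, Finset.card_product,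
    hmu, hU, Finset.card_erase_of_mem (Finset.mem_univ _), Finset.card_univ, hF, add_comm]
  simp only [Finset.mem_image, Finset.mem_product, hU, Finset.mem_erase, Prod.mk.injEq, not_exists]
  rintro ⟨y, c⟩ ⟨⟨⟨hy, _⟩, _⟩, _, h0⟩
  exact hy h0

lemma Tcount_eq {m k : ℕ} (hodd : p % 2 = 1) (hF : Fintype.card F = p ^ (2 * m)) (v : ℂ) :
    Tcount p m (2 * m) k F v = ((coeffPairs p m F).filter fun ab =>
      ∑ x : F, traceChar p F (quadFun p m k ab.1 ab.2 x) = v).card := by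
  rw [Tcount, Nat.card_eq_fintype_card, Fintype.card_subtype]
  congr 1
  ext ab
  simp only [Finset.mem_filter, Finset.mem_univ, true_and, mem_coeffPairs]
  exact and_congr_right fun h => by rw [Tsum_eq hodd hF _ h]

lemma sum_eq_of_four_values {ι : Type*} (P : Finset ι) (T : ι → ℤ) {v₀ v₁ v₂ v₃ : ℤ}
    (h01 : v₀ ≠ v₁) (h02 : v₀ ≠ v₂) (h03 : v₀ ≠ v₃) (h12 : v₁ ≠ v₂) (h13 : v₁ ≠ v₃)
    (h23 : v₂ ≠ v₃) (hT : ∀ i ∈ P, T i = v₀ ∨ T i = v₁ ∨ T i = v₂ ∨ T i = v₃) (f : ℤ → ℤ) :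
    ∑ i ∈ P, f (T i) = ((P.filter fun i => T i = v₀).card : ℤ) * f v₀ +
      ((P.filter fun i => T i = v₁).card : ℤ) * f v₁ +
      ((P.filter fun i => T i = v₂).card : ℤ) * f v₂ +
      ((P.filter fun i => T i = v₃).card : ℤ) * f v₃ := by
  have hmap : ∀ i ∈ P, T i ∈ ({v₀, v₁, v₂, v₃} : Finset ℤ) := fun i hi => by
    simpa using hT i hi
  have hfib : ∀ v, ∑ i ∈ P.filter (fun i => T i = v), f (T i) =
      ((P.filter fun i => T i = v).card : ℤ) * f v := fun v => by
    rw [Finset.sum_congr rfl (g := fun _ => f v), Finset.sum_const, nsmul_eq_mul]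
    intro i hi
    rw [(Finset.mem_filter.1 hi).2]
  rw [← Finset.sum_fiberwise_of_maps_to hmap, Finset.sum_insert (by simp [h01, h02, h03]),
    Finset.sum_insert (by simp [h12, h13]), Finset.sum_insert (by simp [h23]),
    Finset.sum_singleton, hfib, hfib, hfib, hfib]
  ring

end Moments

section Distribution

lemma exists_odd_of_gcd {m k d : ℕ} (hm : 0 < m) (hk : k ≤ 2 * m - 1) (hkm : k ≠ m)
    (hd : d = Nat.gcd m k) (h2d : Nat.gcd (m + k) (2 * k) = 2 * d) :
    ∃ j t, 0 < d ∧ m = d * (3 + j) ∧ k = d * t ∧ Odd (3 + j) ∧ Odd t ∧ (3 + j).Coprime t ∧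
      t ≤ 2 * (3 + j) := by
  have hd0 : 0 < d := hd ▸ Nat.gcd_pos_of_pos_left k hm
  obtain ⟨s, t, hst, hms, hkt⟩ := Nat.exists_coprime m k
  rw [← hd, mul_comm] at hms hkt
  rw [hms, hkt, ← mul_add, mul_left_comm, Nat.gcd_mul_left, mul_comm 2 d] at h2d
  have hgcd := Nat.eq_of_mul_eq_mul_left hd0 h2d
  have h2 : 2 ∣ s + t := hgcd ▸ Nat.gcd_dvd_left (s + t) (2 * t)
  have hnot : ¬(2 ∣ s ∧ 2 ∣ t) := fun h => by
    have := Nat.dvd_gcd h.1 h.2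
    rw [hst.gcd_eq_one] at this
    omega
  have hs : Odd s := by rw [Nat.odd_iff]; omega
  have ht : Odd t := by rw [Nat.odd_iff]; omega
  have hlt : t < 2 * s := by
    refine Nat.lt_of_mul_lt_mul_left (a := d) ?_
    rw [← hkt, mul_left_comm, ← hms]
    omega
  have hs1 : s ≠ 1 := by
    rintro rfl
    have : t = 1 := by rw [Nat.odd_iff] at ht; omega
    exact hkm (by rw [hkt, hms, this])
  have hs3 : 3 ≤ s := by rw [Nat.odd_iff] at hs; omega
  obtain ⟨j, rfl⟩ := Nat.exists_eq_add_of_le hs3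
  exact ⟨j, t, hd0, hms, hkt, hs, ht, hst, hlt.le⟩

/-- The value distribution in terms of `Q = p ^ d` and `M = p ^ m`. -/
lemma distribution {p : ℕ} [hp : Fact p.Prime] {F : Type} [Field F] [Fintype F]
    [Algebra (ZMod p) F] {d s t : ℕ} (hodd : p % 2 = 1) (hd : 0 < d) (hs : Odd s) (ht : Odd t)
    (hst : s.Coprime t) (hts : t ≤ 2 * s) (hs3 : 3 ≤ s)
    (hF : Fintype.card F = p ^ (2 * (d * s))) {M Q : ℤ} (hM : M = (p : ℤ) ^ (d * s))
    (hQ : Q = (p : ℤ) ^ d) :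
    ∃ N : ℤ → ℤ, (∀ v : ℤ, (Tcount p (d * s) (2 * (d * s)) (d * t) F (v : ℂ) : ℤ) = N v) ∧
      N (M ^ 2) = 1 ∧
      N (-M) + N (M * Q) + N (-(M * Q ^ 2)) = M ^ 3 - 1 ∧
      -N (-M) + Q * N (M * Q) - Q ^ 2 * N (-(M * Q ^ 2)) = M ^ 2 - M ∧
      N (-M) + Q ^ 2 * N (M * Q) + Q ^ 4 * N (-(M * Q ^ 2)) =
        M * (1 + (M ^ 2 - 1) * (Q + 1)) - M ^ 2 ∧
      ∀ α β : F, α ^ p ^ (d * s) = α → ∃ v : ℤ, (v = -M ∨ v = M * Q ∨ v = -(M * Q ^ 2) ∨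
        v = M ^ 2) ∧ Tsum p (d * s) (2 * (d * s)) (d * t) F α β = (v : ℂ) := by
  have hm : 0 < d * s := by positivity
  have hQ2 : 2 ≤ Q := by
    rw [hQ]; exact_mod_cast hp.out.two_le.trans (Nat.le_self_pow hd.ne' p)
  have hMQ : M = Q ^ s := by rw [hM, hQ, pow_mul]
  have hMQ3 : Q ^ 3 ≤ M := by rw [hMQ]; exact pow_le_pow_right₀ (by omega) hs3
  have hMpos : 0 < M := lt_of_lt_of_le (by positivity) hMQ3
  have hMQlt : M * Q < M ^ 2 := by
    have : Q < M := lt_of_lt_of_le (by nlinarith [sq_nonneg Q]) hMQ3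
    nlinarith
  have hMQpos : 0 < M * Q := by positivity
  have hMQ2 : M < M * Q ^ 2 := by nlinarith
  choose T hT using fun ab : F × F => exists_int_sum_quadFun hs ht hF ab.1 ab.2
  have hnegM : (-Q) ^ s = -M := by rw [hs.neg_pow, hMQ]
  have hval : ∀ ab : F × F, ab.1 ^ p ^ (d * s) = ab.1 → ¬(ab.1 = 0 ∧ ab.2 = 0) →
      T ab = -M ∨ T ab = M * Q ∨ T ab = -(M * Q ^ 2) := by
    intro ab hab hne
    obtain ⟨r, hr, hTr⟩ := exists_sum_quadFun_eq hodd hd hs ht hst hts hF hab hne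
    rw [(hT ab).1] at hTr
    have hTr' : T ab = (-Q) ^ (s + r) := by rw [hQ]; exact_mod_cast hTr
    rw [pow_add, hnegM] at hTr'
    interval_cases r
    · exact Or.inl (by rw [hTr']; ring)
    · exact Or.inr (Or.inl (by rw [hTr']; ring))
    · exact Or.inr (Or.inr (by rw [hTr']; ring))
  have hzero : T (0, 0) = M ^ 2 := by
    have h := (hT (0, 0)).1
    simp only [quadFun, zero_div, zero_mul, add_zero, AddChar.map_zero_eq_one, Finset.sum_const,
      Finset.card_univ, hF, nsmul_eq_mul, mul_one] at h
    have : T (0, 0) = ((p ^ (2 * (d * s)) : ℕ) : ℤ) := by exact_mod_cast h.symm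
    rw [this, hM]
    push_cast
    ring
  have hval4 : ∀ ab ∈ coeffPairs p (d * s) F,
      T ab = -M ∨ T ab = M * Q ∨ T ab = -(M * Q ^ 2) ∨ T ab = M ^ 2 := by
    intro ab hab
    by_cases h : ab.1 = 0 ∧ ab.2 = 0
    · have : ab = (0, 0) := Prod.ext h.1 h.2
      exact Or.inr (Or.inr (Or.inr (this ▸ hzero)))
    · rcases hval ab (mem_coeffPairs.1 hab) h with h | h | h <;> simp [h]
  set N : ℤ → ℤ := fun v => (((coeffPairs p (d * s) F).filter fun ab => T ab = v).card : ℤ) with hN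
  have hsum := sum_eq_of_four_values (coeffPairs p (d * s) F) T (v₀ := -M) (v₁ := M * Q)
    (v₂ := -(M * Q ^ 2)) (v₃ := M ^ 2) (by linarith) (by linarith) (by linarith) (by linarith)
    (by linarith) (by linarith) hval4
  have hNtop : N (M ^ 2) = 1 := by
    have : (coeffPairs p (d * s) F).filter (fun ab => T ab = M ^ 2) = {(0, 0)} := by
      ext ab
      simp only [Finset.mem_filter, Finset.mem_singleton]
      constructor
      · rintro ⟨hab, h⟩
        by_contra hne
        rcases hval ab (mem_coeffPairs.1 hab) (fun h0 => hne (Prod.ext h0.1 h0.2)) with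
          h' | h' | h' <;> linarith
      · rintro rfl
        exact ⟨mem_coeffPairs.2 (zero_pow (pow_ne_zero _ hp.out.ne_zero)), hzero⟩
    simp only [hN]
    rw [this]
    simp
  have hcount : ((coeffPairs p (d * s) F).card : ℤ) = M ^ 3 := by
    rw [card_coeffPairs hm hF, hM]
    push_cast
    ring
  have hfirst : ∑ ab ∈ coeffPairs p (d * s) F, T ab = M ^ 3 := by
    have h := first_moment (F := F) (k := d * t) hodd hm hF
    rw [Finset.sum_congr rfl fun ab _ => (hT ab).1] at h
    have h' : ∑ ab ∈ coeffPairs p (d * s) F, T ab = (p : ℤ) ^ (3 * (d * s)) := by exact_mod_cast h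
    rw [h', hM]
    ring
  have hsecond : ∑ ab ∈ coeffPairs p (d * s) F, T ab ^ 2 =
      M ^ 3 * (1 + (M ^ 2 - 1) * (Q + 1)) := by
    have h := second_moment (F := F) (k := d * t) hodd hm hF
    rw [Finset.sum_congr rfl fun ab _ => show _ = ((T ab ^ 2 : ℤ) : ℂ) by
      rw [(hT ab).1, map_intCast]; push_cast; ring, card_equal_powers hs ht hst hF] at h
    have h' : ∑ ab ∈ coeffPairs p (d * s) F, T ab ^ 2 = (p : ℤ) ^ (3 * (d * s)) *
        ((1 + (p ^ (2 * (d * s)) - 1) * (p ^ d + 1) : ℕ) : ℤ) := by exact_mod_cast h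
    rw [h', hM, hQ]
    push_cast [Nat.one_le_pow _ _ hp.out.pos]
    ring
  have e0 := hsum fun _ => 1
  have e1 := hsum fun v => v
  have e2 := hsum fun v => v ^ 2
  simp only [Finset.sum_const, nsmul_eq_mul, mul_one, hcount] at e0
  simp only [hfirst] at e1
  simp only [hsecond] at e2
  change M ^ 3 = N (-M) + N (M * Q) + N (-(M * Q ^ 2)) + N (M ^ 2) at e0
  change M ^ 3 = N (-M) * (-M) + N (M * Q) * (M * Q) + N (-(M * Q ^ 2)) * (-(M * Q ^ 2)) +
    N (M ^ 2) * M ^ 2 at e1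
  change _ = N (-M) * (-M) ^ 2 + N (M * Q) * (M * Q) ^ 2 +
    N (-(M * Q ^ 2)) * (-(M * Q ^ 2)) ^ 2 + N (M ^ 2) * (M ^ 2) ^ 2 at e2
  rw [hNtop] at e0 e1 e2
  refine ⟨N, ?_, hNtop, by linarith, ?_, ?_, ?_⟩
  · intro v
    rw [Tcount_eq hodd hF]
    simp only [hN]
    congr 2
    ext ab
    rw [Finset.mem_filter, Finset.mem_filter, (hT ab).1, Int.cast_inj]
  · apply mul_left_cancel₀ hMpos.ne'
    linear_combination -e1
  · apply mul_left_cancel₀ (pow_ne_zero 2 hMpos.ne')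
    linear_combination -e2
  · intro α β hα
    exact ⟨T (α, β), hval4 (α, β) (mem_coeffPairs.2 hα),
      (Tsum_eq hodd hF β hα).trans (hT (α, β)).1⟩

/-- The three moment identities determine the multiplicities of the values `-M`, `M * Q`
and `-(M * Q ^ 2)`. -/
lemma multiplicities_of_moments {Q R M N₀ N₁ N₂ : ℤ} (hQ : Q ≠ 0) (hM : M = Q ^ 3 * R)
    (e0 : N₀ + N₁ + N₂ = M ^ 3 - 1) (e1 : -N₀ + Q * N₁ - Q ^ 2 * N₂ = M ^ 2 - M)
    (e2 : N₀ + Q ^ 2 * N₁ + Q ^ 4 * N₂ = M * (1 + (M ^ 2 - 1) * (Q + 1)) - M ^ 2) :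
    (Q + 1) * (Q ^ 2 - 1) * N₀ = Q ^ 3 * (M - 1) *
      (M ^ 2 - Q ^ 4 * R ^ 2 - Q ^ 3 * R ^ 2 + M - Q ^ 2 * R + 1) ∧
    (Q + 1) ^ 2 * N₁ = Q * (M ^ 2 - 1) * (M + Q ^ 2 * R + Q * R + 1) ∧
    (Q + 1) * (Q ^ 2 - 1) * N₂ = (Q ^ 2 * R - 1) * (M ^ 2 - 1) := by
  subst hM
  refine ⟨?_, ?_, ?_⟩
  · linear_combination -e2 + (Q - Q ^ 2) * e1 + Q ^ 3 * e0
  · apply mul_left_cancel₀ hQ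
    linear_combination e2 + (1 + Q ^ 2) * e1 + Q ^ 2 * e0
  · apply mul_left_cancel₀ hQ
    linear_combination e2 - (Q - 1) * e1 - Q * e0

end Distribution

theorem stmt10 (p m k n d d' : ℕ) (hp : Nat.Prime p) (hodd : p % 2 = 1)
    (hm : 0 < m) (hn : n = 2 * m) (hk : k ≤ n - 1) (hkm : k ≠ m)
    (hd : d = Nat.gcd m k) (hd' : d' = Nat.gcd (m + k) (2 * k))
    (F : Type) [Field F] [Fintype F] [Algebra (ZMod p) F] (hF : Fintype.card F = p ^ n) (hcase : d' = 2 * d) :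
    (((p : ℤ) ^ d + 1) * ((p : ℤ) ^ (2 * d) - 1) * (Tcount p m n k F (-(p : ℂ) ^ m) : ℤ)
        = (p : ℤ) ^ (3 * d) * ((p : ℤ) ^ m - 1) *
          ((p : ℤ) ^ n - (p : ℤ) ^ (n - 2 * d) - (p : ℤ) ^ (n - 3 * d)
            + (p : ℤ) ^ m - (p : ℤ) ^ (m - d) + 1)) ∧
    (((p : ℤ) ^ d + 1) ^ 2 * (Tcount p m n k F ((p : ℂ) ^ (m + d)) : ℤ)
        = (p : ℤ) ^ d * ((p : ℤ) ^ n - 1) *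
          ((p : ℤ) ^ m + (p : ℤ) ^ (m - d) + (p : ℤ) ^ (m - 2 * d) + 1)) ∧
    (((p : ℤ) ^ d + 1) * ((p : ℤ) ^ (2 * d) - 1) * (Tcount p m n k F (-(p : ℂ) ^ (m + 2 * d)) : ℤ)
        = ((p : ℤ) ^ (m - d) - 1) * ((p : ℤ) ^ n - 1)) ∧
    (Tcount p m n k F ((p : ℂ) ^ n) = 1) ∧
    (∀ α β : F, α ^ p ^ m = α →
      Tsum p m n k F α β = -(p : ℂ) ^ m ∨
      Tsum p m n k F α β = (p : ℂ) ^ (m + d) ∨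
      Tsum p m n k F α β = -(p : ℂ) ^ (m + 2 * d) ∨
      Tsum p m n k F α β = (p : ℂ) ^ n) := by
  subst hn
  have : Fact p.Prime := ⟨hp⟩
  obtain ⟨j, t, hd0, rfl, rfl, hs, ht, hst, hts⟩ :=
    exists_odd_of_gcd hm hk hkm hd (by rw [← hd', hcase])
  clear hd hd' hcase
  obtain ⟨N, hN, h3, e0, e1, e2, hvals⟩ :=
    distribution hodd hd0 hs ht hst hts (by omega) hF (M := (p : ℤ) ^ (d * (3 + j))) rfl rfl
  have c0 : -(p : ℂ) ^ (d * (3 + j)) = ((-(p : ℤ) ^ (d * (3 + j)) : ℤ) : ℂ) := by push_cast; rfl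
  have c1 : (p : ℂ) ^ (d * (3 + j) + d) = (((p : ℤ) ^ (d * (3 + j)) * (p : ℤ) ^ d : ℤ) : ℂ) := by
    push_cast; ring
  have c2 : -(p : ℂ) ^ (d * (3 + j) + 2 * d) =
      ((-((p : ℤ) ^ (d * (3 + j)) * ((p : ℤ) ^ d) ^ 2) : ℤ) : ℂ) := by
    push_cast; ring
  have c3 : (p : ℂ) ^ (2 * (d * (3 + j))) = ((((p : ℤ) ^ (d * (3 + j))) ^ 2 : ℤ) : ℂ) := by
    push_cast; ring
  obtain ⟨h0, h1, h2⟩ := multiplicities_of_moments (Q := (p : ℤ) ^ d)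
    (R := (p : ℤ) ^ (d * j)) (pow_ne_zero _ (by exact_mod_cast hp.ne_zero)) (by ring) e0 e1 e2
  have x0 : d * (3 + j) - d = 2 * d + d * j := by
    rw [show d * (3 + j) = 2 * d + d * j + d by ring, Nat.add_sub_cancel]
  have x1 : d * (3 + j) - 2 * d = d + d * j := by
    rw [show d * (3 + j) = d + d * j + 2 * d by ring, Nat.add_sub_cancel]
  have x2 : 2 * (d * (3 + j)) - 2 * d = 4 * d + 2 * (d * j) := by
    rw [show 2 * (d * (3 + j)) = 4 * d + 2 * (d * j) + 2 * d by ring, Nat.add_sub_cancel]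
  have x3 : 2 * (d * (3 + j)) - 3 * d = 3 * d + 2 * (d * j) := by
    rw [show 2 * (d * (3 + j)) = 3 * d + 2 * (d * j) + 3 * d by ring, Nat.add_sub_cancel]
  rw [c0, c1, c2, c3, hN, hN, hN, x0, x1, x2, x3]
  refine ⟨?_, ?_, ?_, by exact_mod_cast (hN _).trans h3, fun α β hα => ?_⟩
  · linear_combination h0
  · linear_combination h1
  · linear_combination h2
  · obtain ⟨v, hv, hT⟩ := hvals α β hα
    rw [hT]
    simpa only [Int.cast_inj] using hv
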